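/- The optimal value E* of Problem 1 decomposes as a two-stage minimization: E* = min over binary pairs (x, y) that satisfy the view-selection constraints [x_v ∈ {0,1}; y_{k,v} ∈ {0,1}; y_{k,r_k} + Σ_{v∈V̄: r_k < v ≤ r_k+Δ_k} y_{k,v} = 1; y_{k,r_k} + Σ_{v∈V̄: r_k−Δ_k ≤ v < r_k} y_{k,v} = 1; y_{k,v} = 0 whenever |v − r_k| > Δ_k; x_v ≥ y_{k,v}] of the quantity E_t*(y) + E_b·Σ_{v∈V̄∖V} x_v + β·Σ_{k∈K} (1 − y_{k,r_k})·E_{u,k}, where E_t*(y) is the optimal value of Problem 3 for the given y; in particular, the change of variables e_{s,v} = t_{s,v}·p_{s,v} identifies the infimum of Problem 1 over (t, p) for fixed (x, y) with E_t*(y). -/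

import Mathlib

noncomputable section

open Finset

/-- The view grid `V̄ = {1 + j/Q : j = 0,…,(V−1)Q} ⊆ ℝ`. -/
def Vbar (V Q : ℕ) : Finset ℝ :=
  (Finset.range ((V - 1) * Q + 1)).image (fun j : ℕ => 1 + (j : ℝ) / Q)

/-- The original views `V = {1,…,V} ⊆ V̄`. -/
def Vorig (V : ℕ) : Finset ℝ :=
  (Finset.range V).image (fun i : ℕ => (i : ℝ) + 1)

/-- The quality grid `{1, 1 + 1/Q, …, V−1}`. -/
def Dset (V Q : ℕ) : Finset ℝ :=
  (Finset.range ((V - 2) * Q + 1)).image (fun j : ℕ => 1 + (j : ℝ) / Q)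

variable {K S : Type*}

/-- Feasibility for Problem 1 (average weighted sum energy minimization):
binary view transmission variables `x`, binary view utilization variables `y`
satisfying the view-selection constraints for requests `r` and qualities `Δ`,
`x ≥ y`, nonnegative time and power allocations `t, p` with per-state time budgets,
and the successful transmission (rate) constraints. -/
def P1Feasible (V Q : ℕ) [Fintype K] [Fintype S]
    (q : S → ℝ) (ch : S → K → ℝ) (B T R n0 : ℝ) (r Δ : K → ℝ)
    (x : ℝ → ℝ) (y : K → ℝ → ℝ) (t p : S → ℝ → ℝ) : Prop :=
  (∀ v ∈ Vbar V Q, x v = 0 ∨ x v = 1) ∧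
  (∀ k : K, ∀ v ∈ Vbar V Q, y k v = 0 ∨ y k v = 1) ∧
  (∀ k : K, y k (r k) +
      ∑ v ∈ (Vbar V Q).filter (fun v => r k < v ∧ v ≤ r k + Δ k), y k v = 1) ∧
  (∀ k : K, y k (r k) +
      ∑ v ∈ (Vbar V Q).filter (fun v => r k - Δ k ≤ v ∧ v < r k), y k v = 1) ∧
  (∀ k : K, ∀ v ∈ Vbar V Q, Δ k < |v - r k| → y k v = 0) ∧
  (∀ k : K, ∀ v ∈ Vbar V Q, y k v ≤ x v) ∧
  (∀ s : S, ∀ v ∈ Vbar V Q, 0 ≤ t s v) ∧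
  (∀ s : S, ∑ v ∈ Vbar V Q, t s v ≤ T) ∧
  (∀ s : S, ∀ v ∈ Vbar V Q, 0 ≤ p s v) ∧
  (∀ k : K, ∀ v ∈ Vbar V Q,
    y k v * R ≤ B / T * ∑ s : S, q s * (t s v * Real.logb 2 (1 + p s v * ch s k / n0)))

/-- The objective of Problem 1: the average weighted sum energy consumption
`E(x,y,t,p)`. -/
def Eobj (V Q : ℕ) [Fintype K] [Fintype S]
    (q : S → ℝ) (Eb : ℝ) (Eu : K → ℝ) (β : ℝ) (r : K → ℝ)
    (x : ℝ → ℝ) (y : K → ℝ → ℝ) (t p : S → ℝ → ℝ) : ℝ :=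
  (∑ s : S, q s * ∑ v ∈ Vbar V Q, t s v * p s v)
    + Eb * ∑ v ∈ Vbar V Q \ Vorig V, x v
    + β * ∑ k : K, (1 - y k (r k)) * Eu k

/-- An optimal solution of Problem 1: feasible and of minimal objective value among
all feasible points. -/
def P1Optimal (V Q : ℕ) [Fintype K] [Fintype S]
    (q : S → ℝ) (ch : S → K → ℝ) (B T R n0 : ℝ) (Eb : ℝ) (Eu : K → ℝ) (β : ℝ)
    (r Δ : K → ℝ) (x : ℝ → ℝ) (y : K → ℝ → ℝ) (t p : S → ℝ → ℝ) : Prop :=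
  P1Feasible V Q q ch B T R n0 r Δ x y t p ∧
  ∀ (x' : ℝ → ℝ) (y' : K → ℝ → ℝ) (t' p' : S → ℝ → ℝ),
    P1Feasible V Q q ch B T R n0 r Δ x' y' t' p' →
    Eobj V Q q Eb Eu β r x y t p ≤ Eobj V Q q Eb Eu β r x' y' t' p'

/-- `φ(t,u) = t·log₂(1 + u/t)` for `t > 0`, and `φ(0,u) = 0`. -/
def phi (t u : ℝ) : ℝ := if t = 0 then 0 else t * Real.logb 2 (1 + u / t)

/-- Feasibility for Problem 3 (time/energy allocation over the view grid, for a given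
`y`): `t, e ≥ 0` on the grid, per-state time budgets, and rate constraints in the
time/energy variables. -/
def P3FeasG (V Q : ℕ) [Fintype K] [Fintype S]
    (q : S → ℝ) (ch : S → K → ℝ) (B T R n0 : ℝ)
    (y : K → ℝ → ℝ) (t e : S → ℝ → ℝ) : Prop :=
  (∀ s : S, ∀ v ∈ Vbar V Q, 0 ≤ t s v) ∧
  (∀ s : S, ∀ v ∈ Vbar V Q, 0 ≤ e s v) ∧
  (∀ s : S, ∑ v ∈ Vbar V Q, t s v ≤ T) ∧
  (∀ k : K, ∀ v ∈ Vbar V Q,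
    y k v * R ≤ B / T * ∑ s : S, q s * phi (t s v) (e s v * ch s k / n0))

/-- The optimal value `E_t*(y)` of Problem 3 over the view grid. -/
def EtstarG (V Q : ℕ) [Fintype K] [Fintype S]
    (q : S → ℝ) (ch : S → K → ℝ) (B T R n0 : ℝ) (y : K → ℝ → ℝ) : ℝ :=
  sInf {z : ℝ | ∃ t e : S → ℝ → ℝ,
    P3FeasG V Q q ch B T R n0 y t e ∧ z = ∑ s : S, q s * ∑ v ∈ Vbar V Q, e s v}

/-- The view-selection constraints of Problem 1 on the binary pair `(x, y)`. -/
def SelFeasible (V Q : ℕ) [Fintype K] (r Δ : K → ℝ)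
    (x : ℝ → ℝ) (y : K → ℝ → ℝ) : Prop :=
  (∀ v ∈ Vbar V Q, x v = 0 ∨ x v = 1) ∧
  (∀ k : K, ∀ v ∈ Vbar V Q, y k v = 0 ∨ y k v = 1) ∧
  (∀ k : K, y k (r k) +
      ∑ v ∈ (Vbar V Q).filter (fun v => r k < v ∧ v ≤ r k + Δ k), y k v = 1) ∧
  (∀ k : K, y k (r k) +
      ∑ v ∈ (Vbar V Q).filter (fun v => r k - Δ k ≤ v ∧ v < r k), y k v = 1) ∧
  (∀ k : K, ∀ v ∈ Vbar V Q, Δ k < |v - r k| → y k v = 0) ∧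
  (∀ k : K, ∀ v ∈ Vbar V Q, y k v ≤ x v)

/-- The resource (time/power) constraints of Problem 1 for a given `y`. -/
def ResFeasible (V Q : ℕ) [Fintype K] [Fintype S]
    (q : S → ℝ) (ch : S → K → ℝ) (B T R n0 : ℝ)
    (y : K → ℝ → ℝ) (t p : S → ℝ → ℝ) : Prop :=
  (∀ s : S, ∀ v ∈ Vbar V Q, 0 ≤ t s v) ∧
  (∀ s : S, ∑ v ∈ Vbar V Q, t s v ≤ T) ∧
  (∀ s : S, ∀ v ∈ Vbar V Q, 0 ≤ p s v) ∧
  (∀ k : K, ∀ v ∈ Vbar V Q,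
    y k v * R ≤ B / T * ∑ s : S, q s * (t s v * Real.logb 2 (1 + p s v * ch s k / n0)))

theorem phi_energy (t p c n : ℝ) :
    phi t (t * p * c / n) = t * Real.logb 2 (1 + p * c / n) := by
  unfold phi
  split_ifs with h
  · simp [h]
  · rw [show t * p * c / n / t = p * c / n by field_simp]

theorem phi_eq_power (t e c n : ℝ) :
    phi t (e * c / n) = t * Real.logb 2 (1 + e / t * c / n) := by
  unfold phi
  split_ifs with h
  · simp [h]
  · rw [show e * c / n / t = e / t * c / n by ring]

theorem mul_div_le_of_nonneg (t : ℝ) {e : ℝ} (he : 0 ≤ e) : t * (e / t) ≤ e := by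
  rcases eq_or_ne t 0 with h | h
  · simpa [h] using he
  · rw [mul_div_cancel₀ _ h]

theorem Vbar_nonempty (V Q : ℕ) : (Vbar V Q).Nonempty := by
  simp [Vbar]

theorem exists_power_logb_ge [Finite K] [Finite S] {ch : S → K → ℝ}
    (hch : ∀ s k, 0 < ch s k) {n0 : ℝ} (hn0 : 0 < n0) (M : ℝ) :
    ∃ P : ℝ, 0 ≤ P ∧ ∀ s k, M ≤ Real.logb 2 (1 + P * ch s k / n0) := by
  have h : ∀ s k, ∀ᶠ P : ℝ in Filter.atTop, M ≤ Real.logb 2 (1 + P * ch s k / n0) := by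
    intro s k
    have hlin : Filter.Tendsto (fun P : ℝ => 1 + P * ch s k / n0) Filter.atTop Filter.atTop :=
      Filter.tendsto_atTop_add_const_left _ _
        ((Filter.tendsto_id.atTop_mul_const (hch s k)).atTop_div_const hn0)
    exact ((Real.tendsto_logb_atTop one_lt_two).comp hlin).eventually_ge_atTop M
  exact ((Filter.eventually_ge_atTop 0).and
    (Filter.eventually_all.2 fun s => Filter.eventually_all.2 (h s))).exists

section Resource

variable [Fintype K] [Fintype S] {V Q : ℕ} {q : S → ℝ} {ch : S → K → ℝ} {B T R n0 : ℝ}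
  {r Δ : K → ℝ} {x : ℝ → ℝ} {y : K → ℝ → ℝ} {t e p : S → ℝ → ℝ}

theorem P1Feasible_iff :
    P1Feasible V Q q ch B T R n0 r Δ x y t p ↔
      SelFeasible V Q r Δ x y ∧ ResFeasible V Q q ch B T R n0 y t p := by
  simp only [P1Feasible, SelFeasible, ResFeasible, and_assoc]

theorem ResFeasible.energy (h : ResFeasible V Q q ch B T R n0 y t p) :
    P3FeasG V Q q ch B T R n0 y t (fun s v => t s v * p s v) := by
  obtain ⟨ht, hT, hp, hrate⟩ := h
  refine ⟨ht, fun s v hv => mul_nonneg (ht s v hv) (hp s v hv), hT, fun k v hv => ?_⟩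
  simpa only [phi_energy] using hrate k v hv

theorem P3FeasG.power (h : P3FeasG V Q q ch B T R n0 y t e) :
    ResFeasible V Q q ch B T R n0 y t (fun s v => e s v / t s v) := by
  obtain ⟨ht, he, hT, hrate⟩ := h
  refine ⟨ht, hT, fun s v hv => div_nonneg (he s v hv) (ht s v hv), fun k v hv => ?_⟩
  simpa only [phi_eq_power] using hrate k v hv

theorem exists_resFeasible (hq : ∀ s, 0 < q s) (hqsum : ∑ s, q s = 1)
    (hch : ∀ s k, 0 < ch s k) (hB : 0 < B) (hT : 0 < T) (hR : 0 < R) (hn0 : 0 < n0)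
    (hy : ∀ k, ∀ v ∈ Vbar V Q, y k v ≤ 1) :
    ∃ t p, ResFeasible V Q q ch B T R n0 y t p := by
  have hN : (0 : ℝ) < (Vbar V Q).card := by exact_mod_cast (Vbar_nonempty V Q).card_pos
  set N : ℝ := ((Vbar V Q).card : ℝ) with hNdef
  obtain ⟨P, hP, hlog⟩ := exists_power_logb_ge hch hn0 (R * N / B)
  refine ⟨fun _ _ => T / N, fun _ _ => P, fun _ _ _ => by positivity, fun s => ?_,
    fun _ _ _ => hP, fun k v hv => ?_⟩
  · rw [Finset.sum_const, nsmul_eq_mul, ← hNdef, mul_div_cancel₀ _ hN.ne']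
  · calc y k v * R ≤ 1 * R := by gcongr; exact hy k v hv
      _ = B / T * ∑ s, q s * (T / N * (R * N / B)) := by
        rw [← Finset.sum_mul, hqsum]
        field_simp
      _ ≤ _ := by
        gcongr with s
        · exact (hq s).le
        · exact hlog s k

theorem ResFeasible.transmission_nonneg (hq : ∀ s, 0 < q s)
    (h : ResFeasible V Q q ch B T R n0 y t p) :
    0 ≤ ∑ s, q s * ∑ v ∈ Vbar V Q, t s v * p s v :=
  Finset.sum_nonneg fun s _ => mul_nonneg (hq s).le <|
    Finset.sum_nonneg fun v hv => mul_nonneg (h.1 s v hv) (h.2.2.1 s v hv)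

theorem EtstarG_nonneg (hq : ∀ s, 0 < q s) : 0 ≤ EtstarG V Q q ch B T R n0 y := by
  refine Real.sInf_nonneg ?_
  rintro _ ⟨t, e, h, rfl⟩
  exact Finset.sum_nonneg fun s _ => mul_nonneg (hq s).le (Finset.sum_nonneg (h.2.1 s))

theorem ResFeasible.EtstarG_le (hq : ∀ s, 0 < q s)
    (h : ResFeasible V Q q ch B T R n0 y t p) :
    EtstarG V Q q ch B T R n0 y ≤ ∑ s, q s * ∑ v ∈ Vbar V Q, t s v * p s v := by
  refine csInf_le ⟨0, ?_⟩ ⟨t, _, h.energy, rfl⟩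
  rintro _ ⟨t, e, h, rfl⟩
  exact Finset.sum_nonneg fun s _ => mul_nonneg (hq s).le (Finset.sum_nonneg (h.2.1 s))

theorem le_EtstarG (hq : ∀ s, 0 < q s) (hne : ∃ t p, ResFeasible V Q q ch B T R n0 y t p)
    {c : ℝ} (hc : ∀ t p, ResFeasible V Q q ch B T R n0 y t p →
      c ≤ ∑ s, q s * ∑ v ∈ Vbar V Q, t s v * p s v) :
    c ≤ EtstarG V Q q ch B T R n0 y := by
  obtain ⟨t₀, p₀, h₀⟩ := hne
  refine le_csInf ⟨_, t₀, _, h₀.energy, rfl⟩ ?_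
  rintro _ ⟨t, e, h, rfl⟩
  refine (hc _ _ h.power).trans (Finset.sum_le_sum fun s _ => ?_)
  exact mul_le_mul_of_nonneg_left
    (Finset.sum_le_sum fun v hv => mul_div_le_of_nonneg _ (h.2.1 s v hv)) (hq s).le

theorem SelFeasible.le_one (h : SelFeasible V Q r Δ x y) :
    ∀ k, ∀ v ∈ Vbar V Q, y k v ≤ 1 := fun k v hv => by
  rcases h.2.1 k v hv with h | h <;> simp [h]

theorem SelFeasible.synthesis_nonneg (h : SelFeasible V Q r Δ x y) (hr : ∀ k, r k ∈ Vbar V Q)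
    {Eb β : ℝ} {Eu : K → ℝ} (hEb : 0 ≤ Eb) (hEu : ∀ k, 0 ≤ Eu k) (hβ : 0 ≤ β) :
    0 ≤ Eb * ∑ v ∈ Vbar V Q \ Vorig V, x v + β * ∑ k, (1 - y k (r k)) * Eu k := by
  refine add_nonneg (mul_nonneg hEb (Finset.sum_nonneg fun v hv => ?_))
    (mul_nonneg hβ (Finset.sum_nonneg fun k _ =>
      mul_nonneg (sub_nonneg.2 (h.le_one k _ (hr k))) (hEu k)))
  rcases h.1 v (Finset.mem_sdiff.1 hv).1 with h | h <;> simp [h]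

end Resource

/-- the optimal value `E*` of Problem 1 decomposes as a two-stage
minimization: the outer stage selects the binary pair `(x,y)` subject to the
view-selection constraints, and the inner stage contributes `E_t*(y)`; moreover, for
each such `(x,y)` the change of variables `e = t·p` identifies the infimum of the
transmission energy of Problem 1 over `(t,p)` with `E_t*(y)`. -/
theorem two_stage_decomposition (V Q : ℕ) (hV : 2 ≤ V) (hQ : 2 ≤ Q)
    [Fintype K] [Fintype S] [Nonempty K] [Nonempty S]
    (q : S → ℝ) (hq : ∀ s, 0 < q s) (hqsum : ∑ s, q s = 1)
    (ch : S → K → ℝ) (hch : ∀ s k, 0 < ch s k)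
    (B T R n0 : ℝ) (hB : 0 < B) (hT : 0 < T) (hR : 0 < R) (hn0 : 0 < n0)
    (Eb : ℝ) (hEb : 0 ≤ Eb) (Eu : K → ℝ) (hEu : ∀ k, 0 ≤ Eu k)
    (β : ℝ) (hβ : 1 ≤ β)
    (r : K → ℝ) (hr : ∀ k, r k ∈ Vbar V Q)
    (Δ : K → ℝ) (hΔ : ∀ k, Δ k ∈ Dset V Q) :
    (sInf {z : ℝ | ∃ (x : ℝ → ℝ) (y : K → ℝ → ℝ) (t p : S → ℝ → ℝ),
        P1Feasible V Q q ch B T R n0 r Δ x y t p ∧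
        z = Eobj V Q q Eb Eu β r x y t p}
      = sInf {z : ℝ | ∃ (x : ℝ → ℝ) (y : K → ℝ → ℝ),
          SelFeasible V Q r Δ x y ∧
          z = EtstarG V Q q ch B T R n0 y
                + Eb * ∑ v ∈ Vbar V Q \ Vorig V, x v
                + β * ∑ k : K, (1 - y k (r k)) * Eu k}) ∧
    (∀ (x : ℝ → ℝ) (y : K → ℝ → ℝ), SelFeasible V Q r Δ x y →
      sInf {z : ℝ | ∃ t p : S → ℝ → ℝ,
          ResFeasible V Q q ch B T R n0 y t p ∧
          z = ∑ s : S, q s * ∑ v ∈ Vbar V Q, t s v * p s v}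
        = EtstarG V Q q ch B T R n0 y) := by
  have hres : ∀ {x : ℝ → ℝ} {y : K → ℝ → ℝ}, SelFeasible V Q r Δ x y →
      ∃ t p, ResFeasible V Q q ch B T R n0 y t p := fun h =>
    exists_resFeasible hq hqsum hch hB hT hR hn0 h.le_one
  have hβ0 : 0 ≤ β := zero_le_one.trans hβ
  constructor
  · by_cases hsel : ∃ (x : ℝ → ℝ) (y : K → ℝ → ℝ), SelFeasible V Q r Δ x y
    · obtain ⟨x₀, y₀, h₀⟩ := hsel
      obtain ⟨t₀, p₀, hr₀⟩ := hres h₀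
      apply le_antisymm
      · refine le_csInf ⟨_, x₀, y₀, h₀, rfl⟩ ?_
        rintro _ ⟨x, y, h, rfl⟩
        rw [add_assoc, ← sub_le_iff_le_add]
        refine le_EtstarG hq (hres h) fun t p htp => ?_
        rw [sub_le_iff_le_add, ← add_assoc]
        refine csInf_le ⟨0, ?_⟩ ⟨x, y, t, p, P1Feasible_iff.2 ⟨h, htp⟩, rfl⟩
        rintro _ ⟨x', y', t', p', h', rfl⟩
        obtain ⟨hs', hr'⟩ := P1Feasible_iff.1 h'
        rw [Eobj, add_assoc]
        exact add_nonneg (hr'.transmission_nonneg hq) (hs'.synthesis_nonneg hr hEb hEu hβ0)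
      · refine le_csInf ⟨_, x₀, y₀, t₀, p₀, P1Feasible_iff.2 ⟨h₀, hr₀⟩, rfl⟩ ?_
        rintro _ ⟨x, y, t, p, h, rfl⟩
        obtain ⟨hs, htp⟩ := P1Feasible_iff.1 h
        refine le_trans (csInf_le ⟨0, ?_⟩ ⟨x, y, hs, rfl⟩)
          (add_le_add_left (add_le_add_left (htp.EtstarG_le hq) _) _)
        rintro _ ⟨x', y', hs', rfl⟩
        rw [add_assoc]
        exact add_nonneg (EtstarG_nonneg hq) (hs'.synthesis_nonneg hr hEb hEu hβ0)
    · congr 1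
      ext z
      constructor
      · rintro ⟨x, y, t, p, h, -⟩
        exact absurd ⟨x, y, (P1Feasible_iff.1 h).1⟩ hsel
      · rintro ⟨x, y, h, -⟩
        exact absurd ⟨x, y, h⟩ hsel
  · intro x y h
    obtain ⟨t₀, p₀, hr₀⟩ := hres h
    apply le_antisymm
    · refine le_EtstarG hq (hres h) fun t p htp => csInf_le ⟨0, ?_⟩ ⟨t, p, htp, rfl⟩
      rintro _ ⟨t', p', h', rfl⟩
      exact h'.transmission_nonneg hq
    · refine le_csInf ⟨_, t₀, p₀, hr₀, rfl⟩ ?_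
      rintro _ ⟨t, p, htp, rfl⟩
      exact htp.EtstarG_le hq
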